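/- arXiv:2310.09420 — 2 statements merged into one kernel-verified Lean document; each statement's English description precedes it below -/
import Mathlib

section
/- Wasserstein–Fisher–Rao distance between a measure and its ε-regularization: Let Ω ⊂ ℝ^d be compact and star-shaped with respect to a set of points with nonempty interior, let ρ ∈ M(Ω,ℝ₊) be a nonnegative Radon measure, and let ρ^ε be its ε-regularization. Then WFR²(ρ, ρ^ε) = O(ε) as ε → 0; that is, there exist C > 0 and ε₀ > 0 such that WFR²(ρ, ρ^ε) ≤ Cε for all ε ∈ (0, ε₀]. -/
open MeasureTheory Topology Filter Set
open scoped ENNReal NNReal Classical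

noncomputable section

/-- Euclidean space `ℝ^d`. -/
abbrev Euc (d : ℕ) : Type := EuclideanSpace ℝ (Fin d)

instance {α β : Type*} [TopologicalSpace α] [TopologicalSpace β]
    {s : Set α} {t : Set β} [CompactSpace s] [CompactSpace t] :
    CompactSpace ↥(s ×ˢ t) :=
  isCompact_iff_compactSpace.mp
    ((isCompact_iff_compactSpace.mpr ‹_›).prod (isCompact_iff_compactSpace.mpr ‹_›))

/-- `V`-valued Radon measures on a compact subset `s`, realized as continuous linear
functionals on `C(s, V)` (Riesz representation). -/
abbrev RMeas {α : Type*} [TopologicalSpace α] (s : Set α) [CompactSpace s]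
    (V : Type*) [NormedAddCommGroup V] [NormedSpace ℝ V] : Type _ :=
  C(↥s, V) →L[ℝ] ℝ

/-- Pairing of a measure with an arbitrary (ambient) function: equals the pairing with
its restriction whenever the latter is continuous, and `0` otherwise. -/
def pairF {α : Type*} [TopologicalSpace α] {s : Set α} [CompactSpace s]
    {V : Type*} [NormedAddCommGroup V] [NormedSpace ℝ V]
    (μ : RMeas s V) (f : α → V) : ℝ :=
  if h : Continuous fun x : ↥s => f ↑x then μ ⟨_, h⟩ else 0

/-- A nonnegative (scalar) Radon measure. -/
def IsNNMeas {α : Type*} [TopologicalSpace α] {s : Set α} [CompactSpace s]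
    (μ : RMeas s ℝ) : Prop :=
  ∀ φ : C(↥s, ℝ), (∀ x, 0 ≤ φ x) → 0 ≤ μ φ

/-- The spatial gradient of a time–space scalar function, as a Euclidean vector. -/
def gradX {d : ℕ} (φ : ℝ × Euc d → ℝ) (p : ℝ × Euc d) : Euc d :=
  (EuclideanSpace.equiv (Fin d) ℝ).symm
    fun i => fderiv ℝ φ p (0, EuclideanSpace.single i 1)

/-- The time–space cylinder `[a,b] × Ω`. -/
abbrev Cyl {d : ℕ} (a b : ℝ) (Ω : Set (Euc d)) : Set (ℝ × Euc d) := Icc a b ×ˢ Ω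

/-- A triple of scalar/vector measures `(ρ, q, r)` on a compact subset. -/
abbrev STriple {d : ℕ} {α : Type*} [TopologicalSpace α] (s : Set α) [CompactSpace s] :
    Type _ :=
  RMeas s ℝ × RMeas s (Euc d) × RMeas s ℝ

/-- The scalar continuity equation `∂ₜρ + div q = r` on `[0,1] × Ω` connecting `ρ₀`
and `ρ₁`, in weak form against `C¹` test functions. -/
def inCES {d : ℕ} (Ω : Set (Euc d)) [CompactSpace Ω]
    (ρ0 ρ1 : RMeas Ω ℝ) (μ : STriple (d := d) (Cyl 0 1 Ω)) : Prop :=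
  ∀ φ : ℝ × Euc d → ℝ, ContDiff ℝ 1 φ →
    pairF μ.1 (fun p => fderiv ℝ φ p (1, 0)) + pairF μ.2.1 (gradX φ) + pairF μ.2.2 φ
      = pairF ρ1 (fun x => φ (1, x)) - pairF ρ0 (fun x => φ (0, x))

/-- Continuous test triples valued in `{(a,b,c) : a + ½|b|² + ½c² ≤ 0}`, whose support
function is the (scalar, `α = β = 1`) Wasserstein–Fisher–Rao infinitesimal cost. -/
structure OTestS {α : Type*} [TopologicalSpace α] (s : Set α) [CompactSpace s]
    (d : ℕ) where
  a : C(↥s, ℝ)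
  b : C(↥s, Euc d)
  c : C(↥s, ℝ)
  con : ∀ x, a x + 2⁻¹ * ‖b x‖ ^ 2 + 2⁻¹ * (c x) ^ 2 ≤ 0

/-- The scalar action `𝒥(ρ,q,r) = ∫ ½(|dq/dλ|² + |dr/dλ|²)·(dρ/dλ)† dλ`, expressed by
duality as a supremum of pairings. -/
def actionS {d : ℕ} {α : Type*} [TopologicalSpace α] {s : Set α} [CompactSpace s]
    (ρ : RMeas s ℝ) (q : RMeas s (Euc d)) (r : RMeas s ℝ) : ℝ≥0∞ :=
  ⨆ T : OTestS s d, ENNReal.ofReal (ρ T.a + q T.b + r T.c)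

/-- The squared Wasserstein–Fisher–Rao distance (`α = β = 1`) between nonnegative
Radon measures on `Ω`. -/
def WFR2 {d : ℕ} (Ω : Set (Euc d)) [CompactSpace Ω] (ρ0 ρ1 : RMeas Ω ℝ) : ℝ≥0∞ :=
  ⨅ μ : {μ : STriple (d := d) (Cyl 0 1 Ω) // inCES Ω ρ0 ρ1 μ ∧ IsNNMeas μ.1},
    actionS (μ : STriple (d := d) (Cyl 0 1 Ω)).1
      (μ : STriple (d := d) (Cyl 0 1 Ω)).2.1 (μ : STriple (d := d) (Cyl 0 1 Ω)).2.2

/-- The functional `b ↦ ∫ ⟪w, b ∘ p⟫ dν`, i.e. the pushforward under `p` of the measure `w ν`. -/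
def weightedPush {α Y V : Type*} [TopologicalSpace α] {s : Set α} [CompactSpace s]
    [NormedAddCommGroup V] [InnerProductSpace ℝ V]
    [TopologicalSpace Y] [CompactSpace Y] [MeasurableSpace Y] [BorelSpace Y]
    (ν : Measure Y) [IsFiniteMeasure ν] (p : C(Y, ↥s)) (w : C(Y, V)) : RMeas s V :=
  LinearMap.mkContinuous
    { toFun := fun b => ∫ y, inner ℝ (w y) (b (p y)) ∂ν
      map_add' := fun a b => by
        simp only [ContinuousMap.add_apply, inner_add_right]
        exact integral_add
          (Continuous.integrable_of_hasCompactSupport (by fun_prop) (.of_compactSpace _))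
          (Continuous.integrable_of_hasCompactSupport (by fun_prop) (.of_compactSpace _))
      map_smul' := fun c b => by
        simp only [ContinuousMap.smul_apply, inner_smul_right, RingHom.id_apply, smul_eq_mul]
        exact integral_const_mul _ _ }
    (‖w‖ * ν.real univ) fun b => by
      refine (norm_integral_le_of_norm_le_const (C := ‖w‖ * ‖b‖) (.of_forall fun y => ?_)).trans
        (le_of_eq (by ring))
      exact (norm_inner_le_norm _ _).trans
        (mul_le_mul (w.norm_coe_le_norm y) (b.norm_coe_le_norm _) (norm_nonneg _) (norm_nonneg _))

theorem weightedPush_apply {α Y V : Type*} [TopologicalSpace α] {s : Set α} [CompactSpace s]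
    [NormedAddCommGroup V] [InnerProductSpace ℝ V]
    [TopologicalSpace Y] [CompactSpace Y] [MeasurableSpace Y] [BorelSpace Y]
    (ν : Measure Y) [IsFiniteMeasure ν] (p : C(Y, ↥s)) (w : C(Y, V)) (b : C(↥s, V)) :
    weightedPush ν p w b = ∫ y, inner ℝ (w y) (b (p y)) ∂ν := rfl

theorem pairF_of_continuous {α : Type*} [TopologicalSpace α] {s : Set α} [CompactSpace s]
    {V : Type*} [NormedAddCommGroup V] [NormedSpace ℝ V]
    (μ : RMeas s V) {f : α → V} (h : Continuous fun x : ↥s => f ↑x) :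
    pairF μ f = μ ⟨_, h⟩ := dif_pos h

theorem pairF_add {α : Type*} [TopologicalSpace α] {s : Set α} [CompactSpace s]
    {V : Type*} [NormedAddCommGroup V] [NormedSpace ℝ V]
    (μ ν : RMeas s V) (f : α → V) : pairF (μ + ν) f = pairF μ f + pairF ν f := by
  unfold pairF
  split_ifs <;> simp

theorem continuous_gradX {d : ℕ} {φ : ℝ × Euc d → ℝ} (hφ : ContDiff ℝ 1 φ) :
    Continuous (gradX φ) := by
  have := hφ.continuous_fderiv one_ne_zero
  unfold gradX
  fun_prop

theorem inner_gradX {d : ℕ} (φ : ℝ × Euc d → ℝ) (p : ℝ × Euc d) (v : Euc d) :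
    inner ℝ v (gradX φ p) = fderiv ℝ φ p (0, v) := by
  have hv : v = ∑ i, v i • EuclideanSpace.single i (1 : ℝ) := by
    ext j
    simp [Pi.single_apply]
  have h : fderiv ℝ φ p (0, v)
      = ((fderiv ℝ φ p).comp (ContinuousLinearMap.inr ℝ ℝ (Euc d))) v := by simp
  rw [h]
  conv_rhs => rw [hv]
  simp [gradX, PiLp.inner_apply, mul_comm]

/-- The infinitesimal cost inequality for a particle of mass `u ^ 2` with velocity `v`. -/
theorem action_integrand_le {V : Type*} [NormedAddCommGroup V] [InnerProductSpace ℝ V]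
    {a c u u' : ℝ} {b v : V} (h : a + 2⁻¹ * ‖b‖ ^ 2 + 2⁻¹ * c ^ 2 ≤ 0) :
    u ^ 2 * a + u ^ 2 * inner ℝ v b + 2 * u * u' * c
      ≤ 2⁻¹ * (u ^ 2 * ‖v‖ ^ 2 + 4 * u' ^ 2) := by
  have h1 := mul_le_mul_of_nonneg_left h (sq_nonneg u)
  have h2 := norm_sub_sq_real v b
  have h3 := mul_nonneg (sq_nonneg u) (sq_nonneg ‖v - b‖)
  rw [h2] at h3
  nlinarith [sq_nonneg (u * c - 2 * u')]

/-- A family of moving particles `z · x` of mass `u ^ 2`, distributed according to `μ`,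
produces a competitor for the Wasserstein–Fisher–Rao distance. -/
theorem exists_triple_of_curves {d : ℕ} {Ω : Set (Euc d)} [CompactSpace Ω]
    {X : Type*} [TopologicalSpace X] [CompactSpace X] [SecondCountableTopology X]
    [MeasurableSpace X] [BorelSpace X] (μ : Measure X) [IsFiniteMeasure μ]
    {z z' : ℝ → X → Euc d} {u u' : ℝ → ℝ}
    (hz : Continuous fun y : X × Icc (0 : ℝ) 1 => z y.2 y.1)
    (hz' : Continuous fun y : X × Icc (0 : ℝ) 1 => z' y.2 y.1)
    (hzmem : ∀ t ∈ Icc (0 : ℝ) 1, ∀ x, z t x ∈ Ω)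
    (hzd : ∀ t ∈ Icc (0 : ℝ) 1, ∀ x, HasDerivAt (fun t => z t x) (z' t x) t)
    (hu' : Continuous u') (hud : ∀ t, HasDerivAt u (u' t) t)
    {K : ℝ} (hK : ∀ t ∈ Icc (0 : ℝ) 1, ∀ x,
      2⁻¹ * (u t ^ 2 * ‖z' t x‖ ^ 2 + 4 * u' t ^ 2) ≤ K) :
    ∃ τ : STriple (d := d) (Cyl 0 1 Ω),
      (∀ φ : ℝ × Euc d → ℝ, ContDiff ℝ 1 φ →
        pairF τ.1 (fun p => fderiv ℝ φ p (1, 0)) + pairF τ.2.1 (gradX φ) + pairF τ.2.2 φ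
          = (∫ x, u 1 ^ 2 * φ (1, z 1 x) ∂μ) - ∫ x, u 0 ^ 2 * φ (0, z 0 x) ∂μ) ∧
      IsNNMeas τ.1 ∧
      ∀ T : OTestS (Cyl 0 1 Ω) d, τ.1 T.a + τ.2.1 T.b + τ.2.2 T.c ≤ K * μ.real univ := by
  have hu : Continuous u := continuous_iff_continuousAt.2 fun t => (hud t).continuousAt
  let ν : Measure (X × Icc (0 : ℝ) 1) := μ.prod volume
  let p : C(X × Icc (0 : ℝ) 1, ↥(Cyl 0 1 Ω)) :=
    ⟨fun y => ⟨(y.2, z y.2 y.1), y.2.2, hzmem _ y.2.2 _⟩,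
      ((continuous_subtype_val.comp continuous_snd).prodMk hz).subtype_mk _⟩
  let wa : C(X × Icc (0 : ℝ) 1, ℝ) := ⟨fun y => u y.2 ^ 2, by fun_prop⟩
  let wb : C(X × Icc (0 : ℝ) 1, Euc d) := ⟨fun y => u y.2 ^ 2 • z' y.2 y.1,
      ((hu.comp (continuous_subtype_val.comp continuous_snd)).pow 2).smul hz'⟩
  let wc : C(X × Icc (0 : ℝ) 1, ℝ) := ⟨fun y => 2 * u y.2 * u' y.2, by fun_prop⟩
  have hsum : ∀ (a : C(↥(Cyl 0 1 Ω), ℝ)) (b : C(↥(Cyl 0 1 Ω), Euc d)) (c : C(↥(Cyl 0 1 Ω), ℝ)),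
      weightedPush ν p wa a + weightedPush ν p wb b + weightedPush ν p wc c
        = ∫ y, (inner ℝ (wa y) (a (p y)) + inner ℝ (wb y) (b (p y))
            + inner ℝ (wc y) (c (p y))) ∂ν := by
    intro a b c
    have hint : ∀ {f : X × Icc (0 : ℝ) 1 → ℝ}, Continuous f → Integrable f ν := fun hf =>
      hf.integrable_of_hasCompactSupport (.of_compactSpace _)
    rw [integral_add (hint (by fun_prop)) (hint (by fun_prop)),
      integral_add (hint (by fun_prop)) (hint (by fun_prop))]
    rfl
  refine ⟨(weightedPush ν p wa, weightedPush ν p wb, weightedPush ν p wc), ?_, ?_, ?_⟩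
  · intro φ hφ
    have hφ' := hφ.continuous_fderiv one_ne_zero
    have hφc := hφ.continuous
    have hg := continuous_gradX hφ
    rw [pairF_of_continuous _ (by fun_prop), pairF_of_continuous _ (by fun_prop),
      pairF_of_continuous _ (by fun_prop), hsum]
    have hcont : Continuous fun y : X × Icc (0 : ℝ) 1 =>
        u y.2 ^ 2 * fderiv ℝ φ (y.2, z y.2 y.1) (1, z' y.2 y.1)
          + 2 * u y.2 * u' y.2 * φ (y.2, z y.2 y.1) := by
      have h1 : Continuous fun y : X × Icc (0 : ℝ) 1 => ((y.2 : ℝ), z y.2 y.1) :=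
        (continuous_subtype_val.comp continuous_snd).prodMk hz
      have h2 := (hφ'.comp h1).clm_apply ((continuous_const (y := (1 : ℝ))).prodMk hz')
      have h3 := hφc.comp h1
      simp only [Function.comp_def] at h2 h3
      fun_prop
    have hder : ∀ x, ∀ t ∈ Icc (0 : ℝ) 1, HasDerivAt (fun t => u t ^ 2 * φ (t, z t x))
        (u t ^ 2 * fderiv ℝ φ (t, z t x) (1, z' t x) + 2 * u t * u' t * φ (t, z t x)) t := by
      intro x t ht
      have h1 := ((hφ.differentiable one_ne_zero _).hasFDerivAt.comp_hasDerivAt t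
        ((hasDerivAt_id t).prodMk (hzd t ht x)))
      refine (((hud t).pow 2).mul h1).congr_deriv ?_
      simp
      ring
    calc _ = ∫ y, (u y.2 ^ 2 * fderiv ℝ φ (y.2, z y.2 y.1) (1, z' y.2 y.1)
          + 2 * u y.2 * u' y.2 * φ (y.2, z y.2 y.1)) ∂ν := by
          refine integral_congr_ae (.of_forall fun y => ?_)
          have : ((1 : ℝ), z' y.2 y.1) = (1, 0) + (0, z' y.2 y.1) := by simp
          simp only [this, map_add, ← inner_gradX]
          simp [wa, wb, wc, p, inner_smul_left]
          ring
      _ = ∫ x, (∫ t : Icc (0 : ℝ) 1, (u t ^ 2 * fderiv ℝ φ (t, z t x) (1, z' t x)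
          + 2 * u t * u' t * φ (t, z t x))) ∂μ :=
          integral_prod _ (hcont.integrable_of_hasCompactSupport (.of_compactSpace _))
      _ = ∫ x, (u 1 ^ 2 * φ (1, z 1 x) - u 0 ^ 2 * φ (0, z 0 x)) ∂μ := by
          refine integral_congr_ae (.of_forall fun x => ?_)
          have hc : ContinuousOn (fun t => u t ^ 2 * fderiv ℝ φ (t, z t x) (1, z' t x)
              + 2 * u t * u' t * φ (t, z t x)) (Icc 0 1) :=
            continuousOn_iff_continuous_domRestrict.2
              (hcont.comp (Continuous.prodMk_right x))
          have := intervalIntegral.integral_eq_sub_of_hasDerivAt (a := 0) (b := 1)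
            (fun t ht => hder x t (by rwa [uIcc_of_le zero_le_one] at ht))
            (hc.intervalIntegrable_of_Icc zero_le_one)
          rw [intervalIntegral.integral_of_le zero_le_one,
            ← integral_Icc_eq_integral_Ioc] at this
          simp only [← this]
          exact integral_subtype_comap (s := Icc (0 : ℝ) 1) (μ := volume) measurableSet_Icc
            fun t => u t ^ 2 * fderiv ℝ φ (t, z t x) (1, z' t x) + 2 * u t * u' t * φ (t, z t x)
      _ = _ := by
          have hend : ∀ s : Icc (0 : ℝ) 1,
              Integrable (fun x => u s ^ 2 * φ (s, z s x)) μ := fun s => by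
            have : Continuous fun x => z s x := hz.comp (Continuous.prodMk_left s)
            exact Continuous.integrable_of_hasCompactSupport (by fun_prop) (.of_compactSpace _)
          exact integral_sub (hend ⟨1, by simp⟩) (hend ⟨0, by simp⟩)
  · intro f hf
    refine integral_nonneg fun y => ?_
    have := mul_nonneg (hf (p y)) (sq_nonneg (u y.2))
    simpa [wa] using this
  · intro T
    dsimp only
    rw [hsum]
    calc _ ≤ ∫ _, K ∂ν := by
          refine integral_mono (Continuous.integrable_of_hasCompactSupport (by fun_prop)
            (.of_compactSpace _)) (integrable_const _) fun y => ?_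
          refine le_trans (le_of_eq ?_)
            ((action_integrand_le (T.con (p y))).trans (hK y.2 y.2.2 y.1))
          simp [wa, wb, wc, inner_smul_left]
          ring
      _ = K * μ.real univ := by
          simp [ν, mul_comm, measureReal_def, ← univ_prod_univ, Measure.prod_prod]

theorem WFR2_le_of_triple {d : ℕ} {Ω : Set (Euc d)} [CompactSpace Ω] {ρ0 ρ1 : RMeas Ω ℝ}
    {K : ℝ} (τ : STriple (d := d) (Cyl 0 1 Ω)) (hce : inCES Ω ρ0 ρ1 τ) (hnn : IsNNMeas τ.1)
    (hK : ∀ T : OTestS (Cyl 0 1 Ω) d, τ.1 T.a + τ.2.1 T.b + τ.2.2 T.c ≤ K) :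
    WFR2 Ω ρ0 ρ1 ≤ ENNReal.ofReal K :=
  iInf_le_of_le ⟨τ, hce, hnn⟩ (iSup_le fun T => ENNReal.ofReal_le_ofReal (hK T))

theorem exists_measure_of_isNNMeas {d : ℕ} {Ω : Set (Euc d)} [CompactSpace Ω] {ρ : RMeas Ω ℝ}
    (hρ : IsNNMeas ρ) :
    ∃ μ : Measure Ω, IsFiniteMeasure μ ∧ ∀ f : C(Ω, ℝ), ρ f = ∫ x, f x ∂μ := by
  let Λ : CompactlySupportedContinuousMap ↥Ω ℝ →ₚ[ℝ] ℝ := PositiveLinearMap.mk₀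
    { toFun := fun f => ρ f.toContinuousMap
      map_add' := fun f g => map_add ρ f.toContinuousMap g.toContinuousMap
      map_smul' := fun c f => map_smul ρ c f.toContinuousMap } fun f hf => hρ _ hf
  refine ⟨RealRMK.rieszMeasure Λ, inferInstance, fun f => ?_⟩
  exact (RealRMK.integral_rieszMeasure Λ
    (CompactlySupportedContinuousMap.continuousMapEquiv f)).symm

theorem smul_mem_of_gauge_lipschitz {E : Type*} [NormedAddCommGroup E] [NormedSpace ℝ E]
    {s : Set E} (hs : IsClosed s) (hstar : StarConvex ℝ 0 s) (h0 : s ∈ 𝓝 0)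
    {L : ℝ} (hL0 : 0 ≤ L) (hLip : LipschitzWith (Real.toNNReal L) (gauge s))
    {x y : E} {δ : ℝ} (hδ : 0 ≤ δ) (hx : x ∈ s) (hxy : ‖y - x‖ ≤ δ) :
    (1 + L * δ)⁻¹ • y ∈ s := by
  have hpos : 0 < 1 + L * δ := by positivity
  have hy : gauge s y ≤ 1 + L * δ := by
    have h1 := hLip.dist_le_mul y x
    rw [Real.dist_eq, Real.coe_toNNReal _ hL0, dist_eq_norm] at h1
    have h2 := gauge_le_one_of_mem hx
    have h3 := mul_le_mul_of_nonneg_left hxy hL0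
    linarith [le_abs_self (gauge s y - gauge s x)]
  have hmem : ∀ r ∈ Ioo (0 : ℝ) 1, r • ((1 + L * δ)⁻¹ • y) ∈ s := by
    intro r hr
    have hg : gauge s (r • ((1 + L * δ)⁻¹ • y)) < 1 := by
      rw [gauge_smul_of_nonneg hr.1.le, gauge_smul_of_nonneg (inv_nonneg.2 hpos.le),
        smul_eq_mul, smul_eq_mul]
      have : (1 + L * δ)⁻¹ * gauge s y ≤ 1 := by
        rw [inv_mul_le_iff₀ hpos]
        linarith
      nlinarith [hr.1, hr.2]
    obtain ⟨b, hb0, hb1, w, hw, hwe⟩ := exists_lt_of_gauge_lt (absorbent_nhds_zero h0) hg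
    rw [← hwe]
    exact hstar.smul_mem hw hb0.le hb1.le
  have htend : Tendsto (fun r : ℝ => r • ((1 + L * δ)⁻¹ • y)) (𝓝[<] 1)
      (𝓝 ((1 : ℝ) • ((1 + L * δ)⁻¹ • y))) :=
    ((continuous_id.smul continuous_const).tendsto 1).mono_left nhdsWithin_le_nhds
  rw [one_smul] at htend
  refine hs.mem_of_tendsto htend ?_
  filter_upwards [Ioo_mem_nhdsLT (zero_lt_one' ℝ)] using hmem

/-- The measure `g dx` on a subset `s`. -/
def densityOn {d : ℕ} (g : Euc d → ℝ) (s : Set (Euc d)) : Measure s :=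
  (volume.withDensity fun x => ENNReal.ofReal (g x)).comap Subtype.val

theorem isFiniteMeasure_densityOn {d : ℕ} {g : Euc d → ℝ} {s : Set (Euc d)}
    (hs : MeasurableSet s) (hg : IntegrableOn g s) : IsFiniteMeasure (densityOn g s) := by
  refine ⟨?_⟩
  rw [densityOn, comap_subtype_coe_apply hs, image_univ, Subtype.range_coe,
    withDensity_apply _ hs]
  exact hg.lintegral_lt_top

theorem integral_densityOn {d : ℕ} {g : Euc d → ℝ} {s : Set (Euc d)} (hs : MeasurableSet s)
    (hg : Measurable g) (hg0 : ∀ x, 0 ≤ g x) (f : Euc d → ℝ) :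
    ∫ x : s, f x ∂(densityOn g s) = ∫ x in s, g x * f x := by
  rw [densityOn, integral_subtype_comap hs]
  refine (setIntegral_withDensity_eq_setIntegral_smul hg.real_toNNReal f hs).trans ?_
  simp [NNReal.smul_def, hg0]

theorem regularization_transport {d : ℕ} {Ω : Set (Euc d)} [CompactSpace Ω] {L R ε : ℝ}
    (hL0 : 0 ≤ L) (hT : ∀ x ∈ Ω, ∀ y δ, 0 ≤ δ → ‖y - x‖ ≤ δ → (1 + L * δ)⁻¹ • y ∈ Ω)
    (hR : ∀ x ∈ Ω, ‖x‖ ≤ R) (hε : ε ∈ Ioc (0 : ℝ) 1)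
    (μ : Measure Ω) [IsFiniteMeasure μ] (κ : Measure (Metric.closedBall (0 : Euc d) 1))
    [IsFiniteMeasure κ] :
    ∃ τ : STriple (d := d) (Cyl 0 1 Ω),
      (∀ φ : ℝ × Euc d → ℝ, ContDiff ℝ 1 φ →
        pairF τ.1 (fun p => fderiv ℝ φ p (1, 0)) + pairF τ.2.1 (gradX φ) + pairF τ.2.2 φ
          = (1 - ε) * (∫ p, φ (1, (1 + L * ε)⁻¹ • ((p.1 : Euc d) + ε • (p.2 : Euc d))) ∂(μ.prod κ))
            - ∫ p, φ (0, (p.1 : Euc d)) ∂(μ.prod κ)) ∧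
      IsNNMeas τ.1 ∧
      ∀ T : OTestS (Cyl 0 1 Ω) d, τ.1 T.a + τ.2.1 T.b + τ.2.2 T.c
        ≤ 2⁻¹ * ((L * (R + 1) + 1) ^ 2 + 4) * ε * (μ.prod κ).real univ := by
  obtain ⟨hε0, hε1⟩ := hε
  have hs0 : 0 ≤ √(1 - ε) := Real.sqrt_nonneg _
  have hs2 : √(1 - ε) ^ 2 = 1 - ε := Real.sq_sqrt (by linarith)
  have hs1 : √(1 - ε) ≤ 1 := Real.sqrt_le_one.2 (by linarith)
  have hsε : 1 - ε ≤ √(1 - ε) := by nlinarith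
  have hpos : ∀ t ∈ Icc (0 : ℝ) 1, 1 ≤ 1 + L * (t * ε) := fun t ht => by
    have := mul_nonneg hL0 (mul_nonneg ht.1 hε0.le)
    linarith
  obtain ⟨τ, hτ, hnn, hcost⟩ := exists_triple_of_curves (Ω := Ω) (μ.prod κ)
    (z := fun t p => (1 + L * (t * ε))⁻¹ • ((p.1 : Euc d) + (t * ε) • (p.2 : Euc d)))
    (z' := fun t p => (1 + L * (t * ε))⁻¹ • (ε • (p.2 : Euc d))
      + (-(L * ε) / (1 + L * (t * ε)) ^ 2) • ((p.1 : Euc d) + (t * ε) • (p.2 : Euc d)))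
    (u := fun t => 1 - t * (1 - √(1 - ε))) (u' := fun _ => -(1 - √(1 - ε)))
    (K := 2⁻¹ * ((L * (R + 1) + 1) ^ 2 + 4) * ε)
    (by
      have h : ∀ y : (Ω × Metric.closedBall (0 : Euc d) 1) × Icc (0 : ℝ) 1,
        1 + L * (y.2 * ε) ≠ 0 := fun y => (zero_lt_one.trans_le (hpos _ y.2.2)).ne'
      fun_prop (disch := exact h))
    (by
      have h : ∀ y : (Ω × Metric.closedBall (0 : Euc d) 1) × Icc (0 : ℝ) 1,
        1 + L * (y.2 * ε) ≠ 0 := fun y => (zero_lt_one.trans_le (hpos _ y.2.2)).ne'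
      have h' : ∀ y : (Ω × Metric.closedBall (0 : Euc d) 1) × Icc (0 : ℝ) 1,
        (1 + L * (y.2 * ε)) ^ 2 ≠ 0 := fun y => pow_ne_zero 2 (h y)
      fun_prop (disch := first | exact h | exact h'))
    (by
      intro t ht p
      refine hT p.1 p.1.2 _ _ (mul_nonneg ht.1 hε0.le) ?_
      have hp : ‖(p.2 : Euc d)‖ ≤ 1 := mem_closedBall_zero_iff.1 p.2.2
      rw [add_sub_cancel_left, norm_smul, Real.norm_of_nonneg (mul_nonneg ht.1 hε0.le)]
      exact mul_le_of_le_one_right (mul_nonneg ht.1 hε0.le) hp)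
    (by
      intro t ht p
      have h1 : HasDerivAt (fun t : ℝ => t * ε) ε t := hasDerivAt_mul_const ε
      have h2 := ((h1.const_mul L).const_add 1).inv (zero_lt_one.trans_le (hpos t ht)).ne'
      exact h2.smul ((h1.smul_const (p.2 : Euc d)).const_add (p.1 : Euc d)))
    continuous_const
    (fun t => by
      simpa using ((hasDerivAt_id t).mul_const (1 - √(1 - ε))).const_sub 1)
    (by
      intro t ht p
      have h1 := hpos t ht
      have hinv : (1 + L * (t * ε))⁻¹ ≤ 1 := inv_le_one_of_one_le₀ h1
      have hinv0 : 0 ≤ (1 + L * (t * ε))⁻¹ := inv_nonneg.2 (zero_le_one.trans h1)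
      have hp : ‖(p.2 : Euc d)‖ ≤ 1 := mem_closedBall_zero_iff.1 p.2.2
      have hx : ‖(p.1 : Euc d)‖ ≤ R := hR _ p.1.2
      have hR0 : 0 ≤ R := (norm_nonneg _).trans hx
      have htε : t * ε ≤ 1 := mul_le_one₀ ht.2 hε0.le hε1
      have htε0 : 0 ≤ t * ε := mul_nonneg ht.1 hε0.le
      have hv1 : ‖(1 + L * (t * ε))⁻¹ • (ε • (p.2 : Euc d))‖ ≤ ε := by
        rw [norm_smul, norm_smul, Real.norm_of_nonneg hinv0, Real.norm_of_nonneg hε0.le]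
        calc _ ≤ 1 * (ε * 1) := by gcongr
          _ = ε := by ring
      have hv2 : ‖(-(L * ε) / (1 + L * (t * ε)) ^ 2)
          • ((p.1 : Euc d) + (t * ε) • (p.2 : Euc d))‖ ≤ L * ε * (R + 1) := by
        rw [norm_smul]
        have ha : ‖-(L * ε) / (1 + L * (t * ε)) ^ 2‖ ≤ L * ε := by
          rw [norm_div, norm_neg, Real.norm_of_nonneg (by positivity),
            Real.norm_of_nonneg (by positivity)]
          exact div_le_self (by positivity) (one_le_pow₀ h1)
        have hb : ‖(p.1 : Euc d) + (t * ε) • (p.2 : Euc d)‖ ≤ R + 1 := by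
          refine (norm_add_le _ _).trans (add_le_add hx ?_)
          rw [norm_smul, Real.norm_of_nonneg htε0]
          exact mul_le_one₀ htε (norm_nonneg _) hp
        exact mul_le_mul ha hb (norm_nonneg _) (by positivity)
      have hv := (norm_add_le _ _).trans (add_le_add hv1 hv2)
      set V := ‖(1 + L * (t * ε))⁻¹ • (ε • (p.2 : Euc d))
        + (-(L * ε) / (1 + L * (t * ε)) ^ 2) • ((p.1 : Euc d) + (t * ε) • (p.2 : Euc d))‖
      have hV : V ^ 2 ≤ (ε * (L * (R + 1) + 1)) ^ 2 :=
        pow_le_pow_left₀ (norm_nonneg _) (hv.trans (le_of_eq (by ring))) 2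
      have hu0 : 0 ≤ 1 - t * (1 - √(1 - ε)) := by nlinarith [ht.1, ht.2]
      have hu1 : 1 - t * (1 - √(1 - ε)) ≤ 1 := by nlinarith [ht.1, ht.2]
      have hu2 : (1 - t * (1 - √(1 - ε))) ^ 2 ≤ 1 := pow_le_one₀ hu0 hu1
      have hu' : (-(1 - √(1 - ε))) ^ 2 ≤ ε ^ 2 := by
        rw [neg_sq]
        exact pow_le_pow_left₀ (by linarith) (by linarith) 2
      have hεε : ε ^ 2 ≤ ε := by nlinarith
      calc _ ≤ 2⁻¹ * (1 * (ε * (L * (R + 1) + 1)) ^ 2 + 4 * ε ^ 2) := by gcongr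
        _ = 2⁻¹ * ((L * (R + 1) + 1) ^ 2 + 4) * ε ^ 2 := by ring
        _ ≤ _ := by gcongr)
  refine ⟨τ, fun φ hφ => ?_, hnn, hcost⟩
  rw [hτ φ hφ, ← integral_const_mul]
  simp [hs2]

theorem regularization_creation {d : ℕ} {Ω S : Set (Euc d)} [CompactSpace Ω] [CompactSpace S]
    (κ : Measure S) [IsFiniteMeasure κ] {c ε : ℝ} (hS : ∀ y ∈ S, c • y ∈ Ω) (hε : 0 ≤ ε) :
    ∃ τ : STriple (d := d) (Cyl 0 1 Ω),
      (∀ φ : ℝ × Euc d → ℝ, ContDiff ℝ 1 φ →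
        pairF τ.1 (fun p => fderiv ℝ φ p (1, 0)) + pairF τ.2.1 (gradX φ) + pairF τ.2.2 φ
          = ε * ∫ y : S, φ (1, c • (y : Euc d)) ∂κ) ∧
      IsNNMeas τ.1 ∧
      ∀ T : OTestS (Cyl 0 1 Ω) d, τ.1 T.a + τ.2.1 T.b + τ.2.2 T.c ≤ 2 * ε * κ.real univ := by
  obtain ⟨τ, hτ, hnn, hcost⟩ := exists_triple_of_curves (Ω := Ω) κ
    (z := fun _ y => c • (y : Euc d)) (z' := fun _ _ => 0) (u := fun t => √ε * t)
    (u' := fun _ => √ε) (K := 2 * ε) (by fun_prop) (by fun_prop) (fun _ _ y => hS y y.2)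
    (fun _ _ _ => hasDerivAt_const _ _) continuous_const (fun t => hasDerivAt_const_mul _)
    (fun t _ y => by
      rw [norm_zero, Real.sq_sqrt hε]
      linarith)
  refine ⟨τ, fun φ hφ => ?_, hnn, hcost⟩
  rw [hτ φ hφ, ← integral_const_mul]
  simp [Real.sq_sqrt hε]

theorem integral_rescale {d : ℕ} {ε : ℝ} (hε : 0 < ε) (θ f : Euc d → ℝ) :
    ∫ y, (ε ^ d)⁻¹ * θ (ε⁻¹ • y) * f y = ∫ v, θ v * f (ε • v) := by
  have h := Measure.integral_comp_smul volume (fun y => (ε ^ d)⁻¹ * θ (ε⁻¹ • y) * f y) ε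
  simp only [inv_smul_smul₀ hε.ne', finrank_euclideanSpace, Fintype.card_fin, mul_assoc,
    integral_const_mul, abs_of_pos (inv_pos.2 (pow_pos hε d)), smul_eq_mul] at h
  have hne : (ε ^ d)⁻¹ ≠ 0 := by positivity
  simp only [mul_assoc, integral_const_mul]
  exact (mul_left_cancel₀ hne h).symm

theorem integral_mollified {d : ℕ} {Ω : Set (Euc d)} [CompactSpace Ω] {θ f : Euc d → ℝ}
    (hθ : Continuous θ) (hθ0 : ∀ x, 0 ≤ θ x)
    (hθsupp : ∀ x : Euc d, x ∉ Metric.closedBall (0 : Euc d) 1 → θ x = 0)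
    (μ : Measure Ω) [IsFiniteMeasure μ]
    [IsFiniteMeasure (densityOn θ (Metric.closedBall 0 1))]
    {ε : ℝ} (hε : 0 < ε) (hf : Continuous f) :
    ∫ y : Euc d, (∫ x : Ω, (ε ^ d)⁻¹ * θ (ε⁻¹ • (y - x)) ∂μ) * f y
      = ∫ p, f ((p.1 : Euc d) + ε • (p.2 : Euc d))
          ∂(μ.prod (densityOn θ (Metric.closedBall 0 1))) := by
  obtain ⟨R, hR⟩ := (isCompact_iff_compactSpace.2 ‹CompactSpace Ω›).isBounded.exists_norm_le
  have hint : Integrable (fun p : Euc d × Ω => (ε ^ d)⁻¹ * θ (ε⁻¹ • (p.1 - p.2)) * f p.1)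
      (volume.prod μ) := by
    refine Continuous.integrable_of_hasCompactSupport (by fun_prop)
      (HasCompactSupport.intro
        ((isCompact_closedBall (0 : Euc d) (R + ε)).prod isCompact_univ) fun p hp => ?_)
    rw [hθsupp, mul_zero, zero_mul]
    contrapose! hp
    have h2 : ‖p.1 - p.2‖ ≤ ε := by
      simpa [norm_smul, abs_of_pos hε, inv_mul_le_iff₀ hε] using hp
    refine ⟨?_, mem_univ _⟩
    rw [mem_closedBall_zero_iff]
    linarith [norm_le_norm_add_norm_sub' p.1 (p.2 : Euc d), hR _ p.2.2]
  calc _ = ∫ y : Euc d, ∫ x : Ω, (ε ^ d)⁻¹ * θ (ε⁻¹ • (y - x)) * f y ∂μ := by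
        simp only [integral_mul_const]
    _ = ∫ x : Ω, (∫ y : Euc d, (ε ^ d)⁻¹ * θ (ε⁻¹ • (y - x)) * f y) ∂μ :=
        integral_integral_swap hint
    _ = ∫ x : Ω, (∫ v : Metric.closedBall (0 : Euc d) 1, f ((x : Euc d) + ε • (v : Euc d))
          ∂(densityOn θ (Metric.closedBall 0 1))) ∂μ := by
        refine integral_congr_ae (.of_forall fun x => ?_)
        dsimp only
        rw [integral_densityOn measurableSet_closedBall hθ.measurable hθ0
            (fun v => f (x + ε • v)), setIntegral_eq_integral_of_forall_compl_eq_zero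
            fun v hv => by rw [hθsupp v hv, zero_mul],
          ← integral_rescale hε θ (fun y => f (x + y)),
          ← integral_add_right_eq_self _ (x : Euc d)]
        simp [add_comm]
    _ = _ := by
        have hc : Continuous fun p : Ω × Metric.closedBall (0 : Euc d) 1 =>
            f ((p.1 : Euc d) + ε • (p.2 : Euc d)) := by fun_prop
        exact (integral_prod _
          (hc.integrable_of_hasCompactSupport (.of_compactSpace _))).symm

/-- Wasserstein–Fisher–Rao distance between a measure and its
`ε`-regularization: for `Ω` compact, star-shaped with respect to a set of points with
nonempty interior (with star center at the origin), a nonnegative Radon measure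
`ρ ∈ M(Ω, ℝ₊)` and its `ε`-regularization `ρ^ε`, one has `WFR²(ρ, ρ^ε) = O(ε)`:
there are `C > 0` and `ε₀ > 0` with `WFR²(ρ, ρ^ε) ≤ C ε` for all `ε ∈ (0, ε₀]`. -/
theorem stmt11_wfr_distance_to_regularization
    {d : ℕ} (hd : 0 < d) (Ω : Set (Euc d)) [CompactSpace Ω]
    (hΩc : IsCompact Ω) (hΩint : (interior Ω).Nonempty)
    -- star-shaped with respect to a set of points with nonempty interior,
    -- with the origin an interior star center
    (hC1 : (0 : Euc d) ∈ interior {c : Euc d | StarConvex ℝ c Ω})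
    -- `L` is a Lipschitz constant of the Minkowski functional (gauge) of `Ω`
    (L : ℝ) (hL0 : 0 ≤ L) (hLip : LipschitzWith (Real.toNNReal L) (gauge Ω))
    -- the mollifier `θ_d` and its rescalings `θ_d^ε`
    (θ : Euc d → ℝ) (hθsm : ContDiff ℝ (⊤ : ℕ∞) θ)
    (hθrad : ∃ w : ℝ → ℝ, ∀ x, θ x = w ‖x‖)
    (hθnn : ∀ x, 0 ≤ θ x)
    (hθsupp : ∀ x : Euc d, x ∉ Metric.closedBall (0 : Euc d) 1 → θ x = 0)
    (hθmass : ∫ x : Euc d, θ x = 1)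
    (θε : ℝ → Euc d → ℝ)
    (hθε : ∀ ε > (0:ℝ), ∀ x, θε ε x = (ε ^ d)⁻¹ * θ (ε⁻¹ • x))
    -- the auxiliary smooth bump `ρ̄` (supported in `Ω₁`, `≥ 1` on `Ω_{1/2}`)
    (ρbar : Euc d → ℝ) (hρbar_sm : ContDiff ℝ (⊤ : ℕ∞) ρbar) (hρbar_nn : ∀ x, 0 ≤ ρbar x)
    (hρbar_supp : ∀ x, x ∉ Metric.cthickening 1 Ω → ρbar x = 0)
    (hρbar_ge : ∀ x ∈ Metric.cthickening (1/2) Ω, 1 ≤ ρbar x)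
    -- `ρ` and its `ε`-regularization
    (ρ : RMeas Ω ℝ) (hρ : IsNNMeas ρ)
    (ε₁ : ℝ) (hε₁ : 0 < ε₁) (ρε : ℝ → RMeas Ω ℝ)
    (hreg : ∀ ε ∈ Ioc (0:ℝ) ε₁, ∀ f : Euc d → ℝ, Continuous f →
      pairF (ρε ε) f
        = (1 - ε) * (∫ y : Euc d,
              (pairF ρ fun x => θε ε (y - x)) * f ((1 + L * ε)⁻¹ • y))
          + ε * (∫ y in Metric.cthickening ε Ω,
              (∫ x : Euc d, θε ε (y - x) * ρbar x) * f ((1 + L * ε)⁻¹ • y))) :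
    ∃ C > (0:ℝ), ∃ ε₀ ∈ Ioc (0:ℝ) ε₁, ∀ ε ∈ Ioc (0:ℝ) ε₀,
      WFR2 Ω ρ (ρε ε) ≤ ENNReal.ofReal (C * ε) := by
  obtain ⟨R, hR⟩ := hΩc.isBounded.exists_norm_le
  have hstar : StarConvex ℝ 0 Ω := interior_subset hC1
  have hsub : {c : Euc d | StarConvex ℝ c Ω} ⊆ Ω := fun c hc => by
    obtain ⟨x, hx⟩ := hΩint
    simpa using hc (interior_subset hx) zero_le_one le_rfl (add_zero 1)
  have hnhds : Ω ∈ 𝓝 (0 : Euc d) :=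
    Filter.mem_of_superset (mem_interior_iff_mem_nhds.1 hC1) hsub
  have hT : ∀ x ∈ Ω, ∀ y δ, 0 ≤ δ → ‖y - x‖ ≤ δ → (1 + L * δ)⁻¹ • y ∈ Ω :=
    fun x hx y δ hδ hxy =>
      smul_mem_of_gauge_lipschitz hΩc.isClosed hstar hnhds hL0 hLip hδ hx hxy
  obtain ⟨μ, hμ, hρμ⟩ := exists_measure_of_isNNMeas hρ
  have hθc := hθsm.continuous
  have hbarc := hρbar_sm.continuous
  have hθint : Integrable θ := Integrable.of_integral_ne_zero (by simp [hθmass])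
  have hκfin := isFiniteMeasure_densityOn (s := Metric.closedBall 0 1) measurableSet_closedBall
    hθint.integrableOn
  set κ := densityOn θ (Metric.closedBall 0 1)
  have hκ : κ.real univ = 1 := by
    have h := integral_densityOn (s := Metric.closedBall 0 1) measurableSet_closedBall
      hθc.measurable hθnn fun _ => 1
    rw [setIntegral_eq_integral_of_forall_compl_eq_zero
      fun v hv => by rw [hθsupp v hv, zero_mul]] at h
    simpa [hθmass] using h
  obtain ⟨M, hM⟩ := HasCompactSupport.exists_bound_of_continuous
    (HasCompactSupport.intro (hΩc.cthickening (r := 1)) hρbar_supp) hbarc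
  have hM0 : 0 ≤ M := (norm_nonneg _).trans (hM 0)
  set V := (volume : Measure (Euc d)).real (Metric.cthickening 1 Ω)
  set A := 2⁻¹ * ((L * (R + 1) + 1) ^ 2 + 4) * μ.real univ
  have hA : 0 ≤ A := by positivity
  have hB : 0 ≤ 2 * (M * V) := by positivity
  refine ⟨A + 2 * (M * V) + 1, by positivity, min ε₁ 1,
    ⟨lt_min hε₁ one_pos, min_le_left _ _⟩, fun ε hε => ?_⟩
  have hε0 : 0 < ε := hε.1
  have hεε₁ : ε ≤ ε₁ := hε.2.trans (min_le_left _ _)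
  have hε1 : ε ≤ 1 := hε.2.trans (min_le_right _ _)
  have hθε' : ∀ x, θε ε x = (ε ^ d)⁻¹ * θ (ε⁻¹ • x) := hθε ε hε0
  have hθεc : Continuous (θε ε) := by
    rw [funext hθε']
    fun_prop
  have hθεmass : ∫ x, θε ε x = 1 := by
    simpa [hθε', hθmass] using integral_rescale hε0 θ fun _ => 1
  have hθε0 : ∀ x, 0 ≤ θε ε x := fun x => by
    rw [hθε']
    exact mul_nonneg (by positivity) (hθnn _)
  have hθεint : Integrable (θε ε) := Integrable.of_integral_ne_zero (by simp [hθεmass])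
  let g : Euc d → ℝ := fun y => ∫ x, θε ε (y - x) * ρbar x
  have hg0 : ∀ y, 0 ≤ g y := fun y =>
    integral_nonneg fun x => mul_nonneg (hθε0 _) (hρbar_nn x)
  have hgM : ∀ y, g y ≤ M := fun y => by
    calc g y ≤ ∫ x, θε ε (y - x) * M :=
          integral_mono_of_nonneg (.of_forall fun x => mul_nonneg (hθε0 _) (hρbar_nn x))
            ((hθεint.comp_sub_left y).mul_const M)
            (.of_forall fun x => mul_le_mul_of_nonneg_left ((le_abs_self _).trans (hM x)) (hθε0 _))
      _ = M := by
          rw [integral_mul_const, integral_sub_left_eq_self (θε ε) volume y, hθεmass, one_mul]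
  have hgmeas : Measurable g := by
    have h : Continuous fun p : Euc d × Euc d => θε ε (p.1 - p.2) * ρbar p.2 := by fun_prop
    exact (StronglyMeasurable.integral_prod_right' h.stronglyMeasurable).measurable
  have hScomp : IsCompact (Metric.cthickening ε Ω) := hΩc.cthickening
  have hSfin : volume (Metric.cthickening ε Ω) ≠ ∞ := hScomp.measure_ne_top
  have : CompactSpace (Metric.cthickening ε Ω) := isCompact_iff_compactSpace.1 hScomp
  have hgint : IntegrableOn g (Metric.cthickening ε Ω) :=
    Measure.integrableOn_of_bounded hSfin hgmeas.aestronglyMeasurable (M := M)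
      (.of_forall fun y => by rw [Real.norm_of_nonneg (hg0 y)]; exact hgM y)
  have := isFiniteMeasure_densityOn hScomp.measurableSet hgint
  have hσ : (densityOn g (Metric.cthickening ε Ω)).real univ ≤ M * V := by
    have h := integral_densityOn hScomp.measurableSet hgmeas hg0 fun _ => 1
    have h' : (densityOn g (Metric.cthickening ε Ω)).real univ
        = ∫ y in Metric.cthickening ε Ω, g y := by simpa using h
    rw [h']
    calc _ ≤ ∫ y in Metric.cthickening ε Ω, M :=
          setIntegral_mono hgint (integrableOn_const hSfin) hgM
      _ = M * (volume : Measure (Euc d)).real (Metric.cthickening ε Ω) := by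
          simp [mul_comm]
      _ ≤ M * V := mul_le_mul_of_nonneg_left (measureReal_mono (Metric.cthickening_mono hε1 Ω)
          (hΩc.cthickening (r := 1)).measure_ne_top) hM0
  have hSmem : ∀ y ∈ Metric.cthickening ε Ω, (1 + L * ε)⁻¹ • y ∈ Ω := fun y hy => by
    rw [hΩc.cthickening_eq_biUnion_closedBall hε0.le] at hy
    obtain ⟨x, hx, hxy⟩ := mem_iUnion₂.1 hy
    exact hT x hx y ε hε0.le (mem_closedBall_iff_norm.1 hxy)
  obtain ⟨τ, hτ, hτnn, hτK⟩ := regularization_transport hL0 hT hR ⟨hε0, hε1⟩ μ κ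
  obtain ⟨σ, hσce, hσnn, hσK⟩ := regularization_creation
    (densityOn g (Metric.cthickening ε Ω)) hSmem hε0.le
  have hmass : (μ.prod κ).real univ = μ.real univ := by
    rw [← univ_prod_univ, measureReal_prod_prod, hκ, mul_one]
  refine (WFR2_le_of_triple (τ + σ) (fun φ hφ => ?_)
    (fun f hf => add_nonneg (hτnn f hf) (hσnn f hf)) (K := (A + 2 * (M * V)) * ε) fun T => ?_).trans
    (ENNReal.ofReal_le_ofReal ?_)
  · have hφc := hφ.continuous
    have h1 := hτ φ hφ
    have h2 := hσce φ hφ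
    have hf : Continuous fun x : Euc d => φ (1, x) := by fun_prop
    have hfT : Continuous fun x : Euc d => φ (1, (1 + L * ε)⁻¹ • x) := by fun_prop
    have h0 : pairF ρ (fun x => φ (0, x)) = ∫ p, φ (0, (p.1 : Euc d)) ∂(μ.prod κ) := by
      rw [pairF_of_continuous _ (by fun_prop), hρμ,
        integral_fun_fst (fun x : Ω => φ (0, (x : Euc d))), hκ, one_smul]
      rfl
    have hmoll : ∀ y, pairF ρ (fun x => θε ε (y - x))
        = ∫ x : Ω, (ε ^ d)⁻¹ * θ (ε⁻¹ • (y - x)) ∂μ := fun y => by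
      rw [pairF_of_continuous _ (by fun_prop), hρμ]
      simp [hθε']
    rw [hreg ε ⟨hε0, hεε₁⟩ _ hf, h0]
    simp only [hmoll]
    rw [integral_mollified hθc hθnn hθsupp μ hε0 hfT,
      ← integral_densityOn hScomp.measurableSet hgmeas hg0 fun y => φ (1, (1 + L * ε)⁻¹ • y),
      Prod.fst_add, Prod.snd_add, Prod.fst_add, Prod.snd_add, pairF_add, pairF_add, pairF_add]
    linarith
  · have h1 := hτK T
    have h2 := hσK T
    have h3 := mul_le_mul_of_nonneg_left hσ (mul_nonneg zero_le_two hε0.le)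
    rw [hmass] at h1
    have h4 : (τ + σ).1 T.a + (τ + σ).2.1 T.b + (τ + σ).2.2 T.c
        = (τ.1 T.a + τ.2.1 T.b + τ.2.2 T.c) + (σ.1 T.a + σ.2.1 T.b + σ.2.2 T.c) := by
      simp only [Prod.fst_add, Prod.snd_add, add_apply]
      ring
    rw [h4]
    refine (add_le_add h1 (h2.trans h3)).trans (le_of_eq ?_)
    simp only [A]
    ring
  · exact mul_le_mul_of_nonneg_right (by linarith) hε0.le

end
end

section
/- Continuity-equation midpoint construction along a Wasserstein–Fisher–Rao geodesic between Dirac masses: Let x, y ∈ Ω with 0 < |x − y| < π, assume the segment [x,y] ⊆ Ω, and let m > 0. Define m̃(s) = m(1 + (2s² − 2s)(1 − cos(|x−y|/2))) for s ∈ [0,1], H = (∫₀¹ m̃(s)⁻¹ ds)⁻¹, and γ(s) = x + (y − x) H ∫₀^s m̃(t)⁻¹ dt (so γ(0) = x, γ(1) = y, |γ′(s)| = |x−y|H/m̃(s)). Define the measures ρ̃ = ∫₀¹ m̃(s)δ_{γ(s)} ds ∈ M(Ω,ℝ₊), q₀ = ∫₀¹ (1−s)m̃(s)γ′(s)δ_{γ(s)}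 ds ∈ M(Ω,ℝ^d), and r₀ = ∫₀¹ (1−s)m̃′(s)δ_{γ(s)} ds ∈ M(Ω,ℝ). Then: (a) ⟨ρ̃ − m δ_x, φ⟩ = ⟨r₀, φ⟩ + ⟨q₀, ∇φ⟩ for all φ ∈ C¹(Ω), i.e. −div q₀ + r₀ = ρ̃ − m δ_x in the weak sense; and (b) 𝒥_Ω(ρ̃, q₀, r₀) = ½∫₀¹ (1−s)² (|γ′(s)|² + |m̃′(s)/m̃(s)|²) m̃(s) ds ≤ c(x, m, y, m). -/
open MeasureTheory Topology Filter Set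
open scoped ENNReal NNReal Classical

noncomputable section

open scoped RealInnerProductSpace Real

/-- The mass along the WFR geodesic between `m δ_x` and `m δ_y`:
`m̃(s) = m (1 + (2s² − 2s)(1 − cos(|x−y|/2)))`. -/
def geoMass {d : ℕ} (x y : Euc d) (m : ℝ) (s : ℝ) : ℝ :=
  m * (1 + (2 * s ^ 2 - 2 * s) * (1 - Real.cos (dist x y / 2)))

/-- The harmonic-mean normalization `H = (∫₀¹ m̃(s)⁻¹ ds)⁻¹`. -/
def geoH {d : ℕ} (x y : Euc d) (m : ℝ) : ℝ :=
  (∫ s in (0:ℝ)..1, (geoMass x y m s)⁻¹)⁻¹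

/-- The geodesic path `γ(s) = x + (y − x) H ∫₀^s m̃(t)⁻¹ dt`. -/
def geoPath {d : ℕ} (x y : Euc d) (m : ℝ) (s : ℝ) : Euc d :=
  x + (geoH x y m * ∫ t in (0:ℝ)..s, (geoMass x y m t)⁻¹) • (y - x)

/-- The velocity `γ′(s) = (H / m̃(s)) (y − x)`. -/
def geoVel {d : ℕ} (x y : Euc d) (m : ℝ) (s : ℝ) : Euc d :=
  (geoH x y m / geoMass x y m s) • (y - x)

/-- The mass derivative `m̃′(s) = m (4s − 2)(1 − cos(|x−y|/2))`. -/
def geoMass' {d : ℕ} (x y : Euc d) (m : ℝ) (s : ℝ) : ℝ :=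
  m * ((4 * s - 2) * (1 - Real.cos (dist x y / 2)))

/-- The Wasserstein–Fisher–Rao cost between weighted Dirac masses:
`c(x, m₀, y, m₁) = 2(m₀ + m₁ − 2√(m₀m₁) cos_{π/2}(|x−y|/2))`. -/
def diracCost {d : ℕ} (x : Euc d) (m0 : ℝ) (y : Euc d) (m1 : ℝ) : ℝ :=
  2 * (m0 + m1 - 2 * Real.sqrt (m0 * m1) * Real.cos (min (dist x y / 2) (π / 2)))

section IntegralFunctional

variable {X V : Type*} [TopologicalSpace X] [CompactSpace X]
  [NormedAddCommGroup V] [InnerProductSpace ℝ V]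

/-- The vector measure `∫₀¹ w(s) δ_{p(s)} ds`, acting on continuous `V`-valued functions. -/
theorem exists_clm_eq_integral_inner {w : ℝ → V} (hw : Continuous w) {p : ℝ → X}
    (hp : Continuous p) :
    ∃ μ : C(X, V) →L[ℝ] ℝ, ∀ f : C(X, V), μ f = ∫ s in (0:ℝ)..1, ⟪w s, f (p s)⟫ := by
  have hc : ∀ f : C(X, V), Continuous fun s => ⟪w s, f (p s)⟫ := fun f =>
    hw.inner (f.continuous.comp hp)
  refine ⟨LinearMap.mkContinuous
    { toFun := fun f => ∫ s in (0:ℝ)..1, ⟪w s, f (p s)⟫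
      map_add' := fun f g => ?_
      map_smul' := fun c f => ?_ } (∫ s in (0:ℝ)..1, ‖w s‖) (fun f => ?_), fun f => rfl⟩
  · simp only [ContinuousMap.add_apply, inner_add_right]
    exact intervalIntegral.integral_add ((hc f).intervalIntegrable _ _)
      ((hc g).intervalIntegrable _ _)
  · simp only [ContinuousMap.smul_apply, real_inner_smul_right, RingHom.id_apply, smul_eq_mul]
    exact intervalIntegral.integral_const_mul _ _
  · change ‖∫ s in (0:ℝ)..1, ⟪w s, f (p s)⟫‖ ≤ _
    rw [← intervalIntegral.integral_mul_const]
    refine (intervalIntegral.norm_integral_le_integral_norm zero_le_one).trans ?_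
    refine intervalIntegral.integral_mono_on zero_le_one ((hc f).norm.intervalIntegrable _ _)
      ((hw.norm.mul continuous_const).intervalIntegrable _ _) fun s _ => ?_
    exact (norm_inner_le_norm _ _).trans
      (mul_le_mul_of_nonneg_left (f.norm_coe_le_norm _) (norm_nonneg _))

end IntegralFunctional

section Geodesic

variable {d : ℕ} {x y : Euc d} {m : ℝ}

theorem geoMass_pos (hxyπ : dist x y < π) (hm : 0 < m) (s : ℝ) : 0 < geoMass x y m s := by
  have hcos : 0 < Real.cos (dist x y / 2) :=
    Real.cos_pos_of_mem_Ioo ⟨by linarith [dist_nonneg (x := x) (y := y), Real.pi_pos],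
      by linarith⟩
  have hcos1 := Real.cos_le_one (dist x y / 2)
  refine mul_pos hm ?_
  nlinarith [mul_nonneg (sq_nonneg (2 * s - 1)) (sub_nonneg.2 hcos1)]

theorem continuous_geoMass : Continuous (geoMass x y m) := by
  unfold geoMass; fun_prop

theorem continuous_geoMass' : Continuous (geoMass' x y m) := by
  unfold geoMass'; fun_prop

theorem hasDerivAt_geoMass (s : ℝ) : HasDerivAt (geoMass x y m) (geoMass' x y m s) s := by
  have h := ((((((hasDerivAt_id s).pow 2).const_mul 2).sub
    ((hasDerivAt_id s).const_mul 2)).mul_const (1 - Real.cos (dist x y / 2))).const_add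
      1).const_mul m
  refine h.congr_deriv ?_
  simp only [geoMass', id]
  norm_num
  ring_nf
  simp

theorem continuous_inv_geoMass (hxyπ : dist x y < π) (hm : 0 < m) :
    Continuous fun s => (geoMass x y m s)⁻¹ :=
  continuous_geoMass.inv₀ fun s => (geoMass_pos hxyπ hm s).ne'

theorem integral_inv_geoMass (hxy0 : 0 < dist x y) (hxyπ : dist x y < π) (hm : 0 < m) :
    ∫ s in (0:ℝ)..1, (geoMass x y m s)⁻¹
      = (dist x y / 2) / (m * Real.sin (dist x y / 2)) := by
  set θ := dist x y / 2 with hθ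
  set σ := Real.sin (θ / 2) with hσ
  set κ := Real.cos (θ / 2) with hκ
  have hs : 0 < σ := Real.sin_pos_of_pos_of_lt_pi (by linarith) (by linarith)
  have hk : 0 < κ := Real.cos_pos_of_mem_Ioo ⟨by linarith, by linarith⟩
  have h1 : σ ^ 2 + κ ^ 2 = 1 := Real.sin_sq_add_cos_sq _
  have hsin : Real.sin θ = 2 * σ * κ := by
    rw [← Real.sin_two_mul]; ring_nf
  have hcos : Real.cos θ = 1 - 2 * σ ^ 2 := by
    have := Real.cos_two_mul (θ / 2)
    rw [show 2 * (θ / 2) = θ by ring] at this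
    rw [this, ← hκ]; linarith
  have hmass : ∀ s, geoMass x y m s = m * (κ ^ 2 + (σ * (2 * s - 1)) ^ 2) := fun s => by
    rw [geoMass, ← hθ, hcos]; linear_combination (-m) * h1
  have hder : ∀ s, HasDerivAt
      (fun s => (2 * m * σ * κ)⁻¹ * Real.arctan (σ / κ * (2 * s - 1)))
      (geoMass x y m s)⁻¹ s := fun s => by
    have h := ((((hasDerivAt_id s).const_mul 2).sub_const 1).const_mul (σ / κ)).arctan.const_mul
      (2 * m * σ * κ)⁻¹
    refine h.congr_deriv ?_
    rw [hmass]
    have : 0 < κ ^ 2 + (σ * (2 * s - 1)) ^ 2 := by positivity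
    have : 0 < 1 + (σ / κ * (2 * s - 1)) ^ 2 := by positivity
    simp only [id]
    field_simp
  have ht : Real.arctan (σ / κ) = θ / 2 := by
    rw [hσ, hκ, ← Real.tan_eq_sin_div_cos]
    exact Real.arctan_tan (by linarith) (by linarith)
  rw [intervalIntegral.integral_eq_sub_of_hasDerivAt (fun s _ => hder s)
    ((continuous_inv_geoMass hxyπ hm).intervalIntegrable _ _), hsin]
  have e1 : σ / κ * (2 * 1 - 1) = σ / κ := by ring
  have e0 : σ / κ * (2 * 0 - 1) = -(σ / κ) := by ring
  simp only [e1, e0, Real.arctan_neg, ht]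
  field_simp
  ring

theorem geoH_eq (hxy0 : 0 < dist x y) (hxyπ : dist x y < π) (hm : 0 < m) :
    geoH x y m = m * Real.sin (dist x y / 2) / (dist x y / 2) := by
  rw [geoH, integral_inv_geoMass hxy0 hxyπ hm, inv_div]

theorem geoH_pos (hxy0 : 0 < dist x y) (hxyπ : dist x y < π) (hm : 0 < m) :
    0 < geoH x y m := by
  have : 0 < Real.sin (dist x y / 2) :=
    Real.sin_pos_of_pos_of_lt_pi (by linarith) (by linarith)
  rw [geoH_eq hxy0 hxyπ hm]
  positivity

theorem hasDerivAt_geoH_mul_integral (hxyπ : dist x y < π) (hm : 0 < m) (s : ℝ) :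
    HasDerivAt (fun s => geoH x y m * ∫ t in (0:ℝ)..s, (geoMass x y m t)⁻¹)
      (geoH x y m / geoMass x y m s) s :=
  ((continuous_inv_geoMass hxyπ hm).integral_hasStrictDerivAt 0 s).hasDerivAt.const_mul _

theorem strictMono_geoH_mul_integral (hxy0 : 0 < dist x y) (hxyπ : dist x y < π)
    (hm : 0 < m) :
    StrictMono fun s => geoH x y m * ∫ t in (0:ℝ)..s, (geoMass x y m t)⁻¹ :=
  strictMono_of_hasDerivAt_pos (fun s => hasDerivAt_geoH_mul_integral hxyπ hm s)
    fun s => div_pos (geoH_pos hxy0 hxyπ hm) (geoMass_pos hxyπ hm s)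

theorem hasDerivAt_geoPath (hxyπ : dist x y < π) (hm : 0 < m) (s : ℝ) :
    HasDerivAt (geoPath x y m) (geoVel x y m s) s :=
  ((hasDerivAt_geoH_mul_integral hxyπ hm s).smul_const (y - x)).const_add x

theorem continuous_geoPath (hxyπ : dist x y < π) (hm : 0 < m) :
    Continuous (geoPath x y m) :=
  continuous_iff_continuousAt.2 fun s => (hasDerivAt_geoPath hxyπ hm s).continuousAt

theorem continuous_geoVel (hxyπ : dist x y < π) (hm : 0 < m) :
    Continuous (geoVel x y m) := by
  have h := continuous_inv_geoMass (x := x) (y := y) hxyπ hm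
  unfold geoVel
  simp only [div_eq_mul_inv]
  fun_prop

theorem geoPath_zero : geoPath x y m 0 = x := by simp [geoPath]

theorem injective_geoPath (hxy0 : 0 < dist x y) (hxyπ : dist x y < π) (hm : 0 < m) :
    Function.Injective (geoPath x y m) := fun _ _ hst =>
  (strictMono_geoH_mul_integral hxy0 hxyπ hm).injective
    (smul_left_injective ℝ (sub_ne_zero.2 (dist_pos.1 hxy0).symm) (add_left_cancel hst))

theorem geoPath_mem_segment (hxy0 : 0 < dist x y) (hxyπ : dist x y < π) (hm : 0 < m)
    {s : ℝ} (hs : s ∈ Icc (0:ℝ) 1) : geoPath x y m s ∈ segment ℝ x y := by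
  rw [segment_eq_image']
  have hmono := (strictMono_geoH_mul_integral hxy0 hxyπ hm).monotone
  refine ⟨_, ⟨?_, ?_⟩, rfl⟩
  · simpa using hmono hs.1
  · refine (hmono hs.2).trans_eq (inv_mul_cancel₀ ?_)
    exact fun h => (geoH_pos hxy0 hxyπ hm).ne' (by rw [geoH, h, inv_zero])

theorem hasDerivAt_comp_geoPath (hxyπ : dist x y < π) (hm : 0 < m) {φ : Euc d → ℝ}
    (hφ : Differentiable ℝ φ) (s : ℝ) :
    HasDerivAt (fun s => φ (geoPath x y m s))
      ⟪geoVel x y m s, gradient φ (geoPath x y m s)⟫ s := by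
  refine ((hφ _).hasFDerivAt.comp_hasDerivAt s (hasDerivAt_geoPath hxyπ hm s)).congr_deriv ?_
  rw [real_inner_comm, gradient, InnerProductSpace.toDual_symm_apply]

theorem geodesic_weak_identity (hxyπ : dist x y < π) (hm : 0 < m) {φ : Euc d → ℝ}
    (hφ : ContDiff ℝ 1 φ) :
    (∫ s in (0:ℝ)..1, geoMass x y m s * φ (geoPath x y m s)) - m * φ x
      = (∫ s in (0:ℝ)..1, (1 - s) * geoMass' x y m s * φ (geoPath x y m s))
        + ∫ s in (0:ℝ)..1,
            (1 - s) * geoMass x y m s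
              * ⟪geoVel x y m s, gradient φ (geoPath x y m s)⟫ := by
  have hM := continuous_geoMass (x := x) (y := y) (m := m)
  have hM' := continuous_geoMass' (x := x) (y := y) (m := m)
  have hγ := continuous_geoPath (x := x) (y := y) hxyπ hm
  have hφγ := hφ.continuous.comp hγ
  have hgrad : Continuous fun s => ⟪geoVel x y m s, gradient φ (geoPath x y m s)⟫ :=
    (continuous_geoVel hxyπ hm).inner
      (((InnerProductSpace.toDual ℝ (Euc d)).symm.continuous.comp
        (hφ.continuous_fderiv one_ne_zero)).comp hγ)
  have c1 : Continuous fun s => geoMass x y m s * φ (geoPath x y m s) := hM.mul hφγ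
  have c2 : Continuous fun s => (1 - s) * geoMass' x y m s * φ (geoPath x y m s) :=
    ((continuous_const.sub continuous_id).mul hM').mul hφγ
  have c3 : Continuous fun s => (1 - s) * geoMass x y m s
      * ⟪geoVel x y m s, gradient φ (geoPath x y m s)⟫ :=
    ((continuous_const.sub continuous_id).mul hM).mul hgrad
  have c23 : Continuous fun s => (1 - s) * geoMass' x y m s * φ (geoPath x y m s)
      + (1 - s) * geoMass x y m s * ⟪geoVel x y m s, gradient φ (geoPath x y m s)⟫ := c2.add c3
  have hder : ∀ s ∈ uIcc (0:ℝ) 1, HasDerivAt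
      (fun s => (1 - s) * geoMass x y m s * φ (geoPath x y m s))
      ((1 - s) * geoMass' x y m s * φ (geoPath x y m s) + (1 - s) * geoMass x y m s
        * ⟪geoVel x y m s, gradient φ (geoPath x y m s)⟫
        - geoMass x y m s * φ (geoPath x y m s)) s := fun s _ => by
    refine ((((hasDerivAt_id s).const_sub 1).mul (hasDerivAt_geoMass s)).mul
      (hasDerivAt_comp_geoPath hxyπ hm (hφ.differentiable one_ne_zero) s)).congr_deriv ?_
    simp only [id, Pi.mul_apply]
    ring
  have h := intervalIntegral.integral_eq_sub_of_hasDerivAt hder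
    ((c23.sub c1).intervalIntegrable _ _)
  rw [intervalIntegral.integral_sub (c23.intervalIntegrable _ _)
    (c1.intervalIntegrable _ _), intervalIntegral.integral_add (c2.intervalIntegrable _ _)
    (c3.intervalIntegrable _ _)] at h
  have h0 : geoMass x y m 0 = m := by simp [geoMass]
  simp only [sub_self, zero_mul, geoPath_zero, h0, sub_zero, one_mul] at h
  linarith

/-- A WFR geodesic between Dirac masses has constant speed. -/
theorem geodesic_speed (hxy0 : 0 < dist x y) (hxyπ : dist x y < π) (hm : 0 < m) (s : ℝ) :
    (‖geoVel x y m s‖ ^ 2 + (geoMass' x y m s / geoMass x y m s) ^ 2) * geoMass x y m s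
      = 2 * diracCost x m y m := by
  have hM := geoMass_pos (x := x) (y := y) hxyπ hm s
  have hmin : min (dist x y / 2) (π / 2) = dist x y / 2 := min_eq_left (by linarith)
  have hvel : ‖geoVel x y m s‖ ^ 2
      = (2 * m * Real.sin (dist x y / 2) / geoMass x y m s) ^ 2 := by
    rw [geoVel, norm_smul, mul_pow, Real.norm_eq_abs, sq_abs, ← dist_eq_norm, dist_comm y x,
      geoH_eq hxy0 hxyπ hm]
    field_simp
  have hsc := Real.sin_sq_add_cos_sq (dist x y / 2)
  rw [hvel, diracCost, hmin, Real.sqrt_mul_self hm.le]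
  field_simp
  simp only [geoMass, geoMass']
  linear_combination (4 * m ^ 2) * hsc

theorem geodesic_midpoint_action_le (hxy0 : 0 < dist x y) (hxyπ : dist x y < π) (hm : 0 < m) :
    2⁻¹ * ∫ s in (0:ℝ)..1, (1 - s) ^ 2 * (‖geoVel x y m s‖ ^ 2
        + (geoMass' x y m s / geoMass x y m s) ^ 2) * geoMass x y m s
      ≤ diracCost x m y m := by
  have hmin : min (dist x y / 2) (π / 2) = dist x y / 2 := min_eq_left (by linarith)
  have hc : 0 ≤ diracCost x m y m := by
    rw [diracCost, hmin, Real.sqrt_mul_self hm.le]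
    nlinarith [Real.cos_le_one (dist x y / 2)]
  simp only [mul_assoc, geodesic_speed hxy0 hxyπ hm]
  have hle : ∫ s in (0:ℝ)..1, (1 - s) ^ 2 * (2 * diracCost x m y m)
      ≤ ∫ _ in (0:ℝ)..1, 2 * diracCost x m y m := by
    refine intervalIntegral.integral_mono_on zero_le_one
      (Continuous.intervalIntegrable (by fun_prop) _ _)
      (Continuous.intervalIntegrable (by fun_prop) _ _) fun s hs => ?_
    exact mul_le_of_le_one_left (by positivity)
      (pow_le_one₀ (by linarith [hs.2]) (by linarith [hs.1]))
  simp only [intervalIntegral.integral_const, sub_zero, one_smul] at hle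
  linarith

end Geodesic

section Action

variable {d : ℕ} {α : Type*} [TopologicalSpace α] [T2Space α]

/-- The action of a triple concentrated on a simple curve `p` in a compact set, with mass
density `M > 0`, velocity `v` and growth rate `g` along the curve. -/
theorem actionS_curve {s : Set α} [CompactSpace s] {p : ℝ → s} (hp : Continuous p)
    (hinj : InjOn p (Icc 0 1)) {M g : ℝ → ℝ} {v : ℝ → Euc d} (hM : Continuous M)
    (hM0 : ∀ t, 0 ≤ M t) (hv : Continuous v) (hg : Continuous g)
    {ρ : RMeas s ℝ} {q : RMeas s (Euc d)} {r : RMeas s ℝ}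
    (hρ : ∀ f, ρ f = ∫ t in (0:ℝ)..1, ⟪M t, f (p t)⟫)
    (hq : ∀ f, q f = ∫ t in (0:ℝ)..1, ⟪M t • v t, f (p t)⟫)
    (hr : ∀ f, r f = ∫ t in (0:ℝ)..1, ⟪M t * g t, f (p t)⟫) :
    actionS ρ q r
      = ENNReal.ofReal (2⁻¹ * ∫ t in (0:ℝ)..1, (‖v t‖ ^ 2 + g t ^ 2) * M t) := by
  have hsum : ∀ T : OTestS s d, ρ T.a + q T.b + r T.c
      = ∫ t in (0:ℝ)..1, M t * (T.a (p t) + ⟪v t, T.b (p t)⟫ + g t * T.c (p t)) := fun T => by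
    have ca : Continuous fun t => ⟪M t, T.a (p t)⟫ := hM.inner (T.a.continuous.comp hp)
    have cb : Continuous fun t => ⟪M t • v t, T.b (p t)⟫ :=
      (hM.smul hv).inner (T.b.continuous.comp hp)
    have cc : Continuous fun t => ⟪M t * g t, T.c (p t)⟫ :=
      (hM.mul hg).inner (T.c.continuous.comp hp)
    have cab : Continuous fun t => ⟪M t, T.a (p t)⟫ + ⟪M t • v t, T.b (p t)⟫ := ca.add cb
    rw [hρ, hq, hr, ← intervalIntegral.integral_add (ca.intervalIntegrable _ _)
      (cb.intervalIntegrable _ _), ← intervalIntegral.integral_add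
      (cab.intervalIntegrable _ _) (cc.intervalIntegrable _ _)]
    refine intervalIntegral.integral_congr fun t _ => ?_
    simp only [real_inner_smul_left, RCLike.inner_apply, conj_trivial]
    ring
  refine le_antisymm (iSup_le fun T => ENNReal.ofReal_le_ofReal ?_) ?_
  · rw [hsum, ← intervalIntegral.integral_const_mul]
    refine intervalIntegral.integral_mono_on zero_le_one
      (Continuous.intervalIntegrable ?_ _ _) (Continuous.intervalIntegrable ?_ _ _)
      fun t _ => ?_
    · exact hM.mul (((T.a.continuous.comp hp).add (hv.inner (T.b.continuous.comp hp))).add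
        (hg.mul (T.c.continuous.comp hp)))
    · exact continuous_const.mul (((hv.norm.pow 2).add (hg.pow 2)).mul hM)
    · have hyoung := norm_sub_sq_real (v t) (T.b (p t))
      rw [show 2⁻¹ * ((‖v t‖ ^ 2 + g t ^ 2) * M t) = M t * (2⁻¹ * (‖v t‖ ^ 2 + g t ^ 2)) by ring]
      refine mul_le_mul_of_nonneg_left ?_ (hM0 t)
      nlinarith [T.con (p t), sq_nonneg ‖v t - T.b (p t)‖, sq_nonneg (g t - T.c (p t))]
  · have hemb : IsClosedEmbedding fun t : Icc (0:ℝ) 1 => p t :=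
      (hp.comp continuous_subtype_val).isClosedEmbedding fun a b hab =>
        Subtype.ext (hinj a.2 b.2 hab)
    obtain ⟨σ, hσ⟩ := ContinuousMap.exists_extension' hemb
      (⟨Subtype.val, continuous_subtype_val⟩ : C(Icc (0:ℝ) 1, ℝ))
    have hσp : ∀ t ∈ Icc (0:ℝ) 1, σ (p t) = t := fun t ht => congrFun hσ ⟨t, ht⟩
    let T : OTestS s d :=
      { a := ⟨fun z => -(2⁻¹ * ‖v (σ z)‖ ^ 2 + 2⁻¹ * g (σ z) ^ 2), by fun_prop⟩
        b := ⟨fun z => v (σ z), by fun_prop⟩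
        c := ⟨fun z => g (σ z), by fun_prop⟩
        con := fun z => by simp only [ContinuousMap.coe_mk]; linarith }
    refine le_trans (ENNReal.ofReal_le_ofReal (le_of_eq ?_))
      (le_iSup (fun T : OTestS s d => ENNReal.ofReal (ρ T.a + q T.b + r T.c)) T)
    rw [hsum, ← intervalIntegral.integral_const_mul]
    refine intervalIntegral.integral_congr fun t ht => ?_
    rw [uIcc_of_le zero_le_one] at ht
    simp only [T, ContinuousMap.coe_mk, hσp t ht, real_inner_self_eq_norm_sq]
    ring

end Action

/-- Continuity-equation midpoint construction along a WFR geodesic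
between Dirac masses: with `ρ̃ = ∫₀¹ m̃(s) δ_{γ(s)} ds`, `q₀ = ∫₀¹ (1−s) m̃(s) γ′(s)
δ_{γ(s)} ds` and `r₀ = ∫₀¹ (1−s) m̃′(s) δ_{γ(s)} ds`, one has (a)
`−div q₀ + r₀ = ρ̃ − m δ_x` weakly, and (b)
`𝒥_Ω(ρ̃, q₀, r₀) = ½∫₀¹ (1−s)²(|γ′(s)|² + |m̃′(s)/m̃(s)|²) m̃(s) ds ≤ c(x, m, y, m)`. -/
theorem stmt18_wfr_geodesic_midpoint_construction
    {d : ℕ} (Ω : Set (Euc d)) [CompactSpace Ω] (hΩc : IsCompact Ω)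
    (x y : Euc d) (hx : x ∈ Ω) (hy : y ∈ Ω)
    (hxy0 : 0 < dist x y) (hxyπ : dist x y < π)
    (hseg : segment ℝ x y ⊆ Ω)
    (m : ℝ) (hm : 0 < m) :
    -- (a) the weak identity `⟨ρ̃ − m δ_x, φ⟩ = ⟨r₀, φ⟩ + ⟨q₀, ∇φ⟩` for `φ ∈ C¹`
    (∀ φ : Euc d → ℝ, ContDiff ℝ 1 φ →
      (∫ s in (0:ℝ)..1, geoMass x y m s * φ (geoPath x y m s)) - m * φ x
        = (∫ s in (0:ℝ)..1, (1 - s) * geoMass' x y m s * φ (geoPath x y m s))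
          + ∫ s in (0:ℝ)..1,
              (1 - s) * geoMass x y m s
                * ⟪geoVel x y m s, gradient φ (geoPath x y m s)⟫) ∧
    -- (b) the action identity and bound for the measures `(ρ̃, q₀, r₀)`
    (∃ (ρt : RMeas Ω ℝ) (q0 : RMeas Ω (Euc d)) (r0 : RMeas Ω ℝ),
      (∀ f : Euc d → ℝ, Continuous f →
        pairF ρt f = ∫ s in (0:ℝ)..1, geoMass x y m s * f (geoPath x y m s)) ∧
      (∀ g : Euc d → Euc d, Continuous g →
        pairF q0 g = ∫ s in (0:ℝ)..1,
          (1 - s) * geoMass x y m s * ⟪geoVel x y m s, g (geoPath x y m s)⟫) ∧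
      (∀ f : Euc d → ℝ, Continuous f →
        pairF r0 f = ∫ s in (0:ℝ)..1, (1 - s) * geoMass' x y m s * f (geoPath x y m s)) ∧
      actionS ρt q0 r0
        = ENNReal.ofReal (2⁻¹ * ∫ s in (0:ℝ)..1,
            (1 - s) ^ 2 * (‖geoVel x y m s‖ ^ 2
              + (geoMass' x y m s / geoMass x y m s) ^ 2) * geoMass x y m s) ∧
      actionS ρt q0 r0 ≤ ENNReal.ofReal (diracCost x m y m)) := by
  refine ⟨fun φ hφ => geodesic_weak_identity hxyπ hm hφ, ?_⟩
  have hM := continuous_geoMass (x := x) (y := y) (m := m)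
  have hM' := continuous_geoMass' (x := x) (y := y) (m := m)
  have hV := continuous_geoVel (x := x) (y := y) hxyπ hm
  have hM0 := geoMass_pos (x := x) (y := y) hxyπ hm
  have hv : Continuous fun s => (1 - s) • geoVel x y m s := by fun_prop
  have hg : Continuous fun s => (1 - s) * (geoMass' x y m s / geoMass x y m s) :=
    (continuous_const.sub continuous_id).mul (hM'.div hM fun s => (hM0 s).ne')
  have hmem : ∀ s : Icc (0:ℝ) 1, geoPath x y m s ∈ Ω := fun s =>
    hseg (geoPath_mem_segment hxy0 hxyπ hm s.2)
  let p : ℝ → Ω := IccExtend zero_le_one fun s => ⟨geoPath x y m s, hmem s⟩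
  have hp : Continuous p :=
    (((continuous_geoPath hxyπ hm).comp continuous_subtype_val).subtype_mk hmem).Icc_extend'
  have hpval : ∀ s ∈ Icc (0:ℝ) 1, (p s : Euc d) = geoPath x y m s := fun s hs => by
    simp only [p, IccExtend_of_mem _ _ hs]
  have hinj : InjOn p (Icc 0 1) := fun s hs t ht hst =>
    injective_geoPath hxy0 hxyπ hm (by rw [← hpval s hs, ← hpval t ht, hst])
  obtain ⟨ρt, hρ⟩ := exists_clm_eq_integral_inner hM hp
  obtain ⟨q0, hq⟩ := exists_clm_eq_integral_inner (hM.smul hv) hp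
  obtain ⟨r0, hr⟩ := exists_clm_eq_integral_inner (hM.mul hg) hp
  have hact : actionS ρt q0 r0
      = ENNReal.ofReal (2⁻¹ * ∫ s in (0:ℝ)..1,
          (1 - s) ^ 2 * (‖geoVel x y m s‖ ^ 2
            + (geoMass' x y m s / geoMass x y m s) ^ 2) * geoMass x y m s) := by
    rw [actionS_curve hp hinj hM (fun t => (hM0 t).le) hv hg hρ hq hr]
    congr 2
    refine intervalIntegral.integral_congr fun s _ => ?_
    simp only [norm_smul, mul_pow, Real.norm_eq_abs, sq_abs]
    ring
  refine ⟨ρt, q0, r0, fun f hf => ?_, fun f hf => ?_, fun f hf => ?_, hact,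
    hact.trans_le (ENNReal.ofReal_le_ofReal (geodesic_midpoint_action_le hxy0 hxyπ hm))⟩
  all_goals
    rw [pairF, dif_pos (by fun_prop)]
    first | rw [hρ] | rw [hq] | rw [hr]
    refine intervalIntegral.integral_congr fun s hs => ?_
    rw [uIcc_of_le zero_le_one] at hs
    have := (hM0 s).ne'
    simp only [ContinuousMap.coe_mk, hpval s hs, real_inner_smul_left, RCLike.inner_apply,
      conj_trivial, Pi.mul_apply, Pi.smul_apply']
    try field_simp

end
end
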